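/- arXiv:2409.07119 — 5 statements merged into one kernel-verified Lean document; each statement's English description precedes it below -/
import Mathlib

section
/- There exists an epistemic space 𝔼 (over a signature with a single atom a, with two epistemic states Ψ_⊥ and Ψ_a where ⟦Ψ_⊥⟧ = ∅ and ⟦Ψ_a⟧ = {a}) and a belief change operator ∘ for 𝔼 (defined by: Ψ∘α = Ψ_a if ⟦α⟧ = {a}; Ψ∘α = Ψ_⊥ if ⟦α⟧ = {ā} or ⟦α⟧ = ∅; Ψ∘α = Ψ if ⟦α⟧ = {a, ā}) such that ∘ satisfies (CL1), (CL2), (CL4), (CL5), and (CL6) but violates (CL3). -/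
namespace CLR

/-- Propositional formulas over a signature `V` (with falsum `⊥` and implication;
other connectives are defined). -/
inductive Form (V : Type) : Type
  | atom : V → Form V
  | fls  : Form V
  | imp  : Form V → Form V → Form V

namespace Form

variable {V : Type}

/-- Negation `¬φ := φ → ⊥`. -/
def neg (φ : Form V) : Form V := Form.imp φ Form.fls

/-- Verum `⊤ := ¬⊥`. -/
def tru : Form V := neg (Form.fls : Form V)

/-- Disjunction `φ ∨ ψ := ¬φ → ψ`. -/
def or' (φ ψ : Form V) : Form V := Form.imp (neg φ) ψ

/-- Conjunction `φ ∧ ψ := ¬(¬φ ∨ ¬ψ)`. -/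
def and' (φ ψ : Form V) : Form V := neg (or' (neg φ) (neg ψ))

/-- Evaluation of a formula in an interpretation `w : V → Bool`. -/
def eval (w : V → Bool) : Form V → Bool
  | atom v => w v
  | fls => false
  | imp φ ψ => !(eval w φ) || eval w ψ

end Form

/-- Interpretations (possible worlds) over signature `V`. -/
abbrev World (V : Type) := V → Bool

/-- The set of models `⟦φ⟧` of a formula. -/
def mods {V : Type} (φ : Form V) : Set (World V) := {w | φ.eval w = true}

/-- The set of models `⟦X⟧` of a set of formulas. -/
def modsSet {V : Type} (X : Set (Form V)) : Set (World V) :=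
  {w | ∀ φ ∈ X, φ.eval w = true}

/-- Deductive closure (via semantic entailment, which is adequate for
classical propositional logic). -/
def Cn {V : Type} (X : Set (Form V)) : Set (Form V) :=
  {φ | ∀ w ∈ modsSet X, w ∈ mods φ}

/-- Expansion: `X + α` is the deductive closure of `X ∪ {α}`. -/
def plus {V : Type} (X : Set (Form V)) (α : Form V) : Set (Form V) :=
  Cn (X ∪ {α})

/-- A formula is consistent if it has a model. -/
def FormConsistent {V : Type} (φ : Form V) : Prop := (mods φ).Nonempty

/-- A set of formulas is consistent if it has a model. -/
def SetConsistent {V : Type} (X : Set (Form V)) : Prop := (modsSet X).Nonempty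

/-- An epistemic space `𝔼 = ⟨ℰ, B⟩`: each epistemic state `Ψ : E` has a
deductively closed belief set `B Ψ`. -/
structure EpistemicSpace (V E : Type) where
  B : E → Set (Form V)
  closed : ∀ Ψ, B Ψ = Cn (B Ψ)

variable {V E : Type}

/-- Models `⟦Ψ⟧` of the belief set of an epistemic state. -/
def modsOf (ES : EpistemicSpace V E) (Ψ : E) : Set (World V) := modsSet (ES.B Ψ)

/-- (R1) `α ∈ B(Ψ∘α)`. -/
def R1 (ES : EpistemicSpace V E) (circ : E → Form V → E) : Prop :=
  ∀ Ψ α, α ∈ ES.B (circ Ψ α)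

/-- (R2) `B(Ψ∘α) = B(Ψ)+α` whenever `B(Ψ)+α` is consistent. -/
def R2 (ES : EpistemicSpace V E) (circ : E → Form V → E) : Prop :=
  ∀ Ψ α, SetConsistent (plus (ES.B Ψ) α) → ES.B (circ Ψ α) = plus (ES.B Ψ) α

/-- (R3) if `α` is consistent then `B(Ψ∘α)` is consistent. -/
def R3 (ES : EpistemicSpace V E) (circ : E → Form V → E) : Prop :=
  ∀ Ψ α, FormConsistent α → SetConsistent (ES.B (circ Ψ α))

/-- (R4) if `α ≡ β` then `B(Ψ∘α) = B(Ψ∘β)`. -/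
def R4 (ES : EpistemicSpace V E) (circ : E → Form V → E) : Prop :=
  ∀ Ψ α β, mods α = mods β → ES.B (circ Ψ α) = ES.B (circ Ψ β)

/-- (R5) `B(Ψ∘(α∧β)) ⊆ B(Ψ∘α)+β`. -/
def R5 (ES : EpistemicSpace V E) (circ : E → Form V → E) : Prop :=
  ∀ Ψ α β, ES.B (circ Ψ (Form.and' α β)) ⊆ plus (ES.B (circ Ψ α)) β

/-- (R6) if `B(Ψ∘α)+β` is consistent then `B(Ψ∘α)+β ⊆ B(Ψ∘(α∧β))`. -/
def R6 (ES : EpistemicSpace V E) (circ : E → Form V → E) : Prop :=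
  ∀ Ψ α β, SetConsistent (plus (ES.B (circ Ψ α)) β) →
    plus (ES.B (circ Ψ α)) β ⊆ ES.B (circ Ψ (Form.and' α β))

/-- AGM revision operator: satisfies (R1)–(R6). -/
def AGMRev (ES : EpistemicSpace V E) (circ : E → Form V → E) : Prop :=
  R1 ES circ ∧ R2 ES circ ∧ R3 ES circ ∧ R4 ES circ ∧ R5 ES circ ∧ R6 ES circ

/-- (CL1) `α ∈ B(Ψ∘α)` or `B(Ψ∘α) = B(Ψ)`. -/
def CL1 (ES : EpistemicSpace V E) (circ : E → Form V → E) : Prop :=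
  ∀ Ψ α, α ∈ ES.B (circ Ψ α) ∨ ES.B (circ Ψ α) = ES.B Ψ

/-- (CL2) `B(Ψ∘α) = B(Ψ)+α` whenever `B(Ψ)+α` is consistent. -/
def CL2 (ES : EpistemicSpace V E) (circ : E → Form V → E) : Prop :=
  ∀ Ψ α, SetConsistent (plus (ES.B Ψ) α) → ES.B (circ Ψ α) = plus (ES.B Ψ) α

/-- (CL3) `B(Ψ∘α)` is consistent. -/
def CL3 (ES : EpistemicSpace V E) (circ : E → Form V → E) : Prop :=
  ∀ Ψ α, SetConsistent (ES.B (circ Ψ α))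

/-- (CL4) if `α ≡ β` then `B(Ψ∘α) = B(Ψ∘β)`. -/
def CL4 (ES : EpistemicSpace V E) (circ : E → Form V → E) : Prop :=
  ∀ Ψ α β, mods α = mods β → ES.B (circ Ψ α) = ES.B (circ Ψ β)

/-- (CL5) if `α ∈ B(Ψ∘α)` and `α ⊨ β` then `β ∈ B(Ψ∘β)`. -/
def CL5 (ES : EpistemicSpace V E) (circ : E → Form V → E) : Prop :=
  ∀ Ψ α β, α ∈ ES.B (circ Ψ α) → mods α ⊆ mods β → β ∈ ES.B (circ Ψ β)

/-- (CL6) `B(Ψ∘(α∨β))` equals `B(Ψ∘α)`, or `B(Ψ∘β)`, or `B(Ψ∘α) ∩ B(Ψ∘β)`. -/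
def CL6 (ES : EpistemicSpace V E) (circ : E → Form V → E) : Prop :=
  ∀ Ψ α β,
    ES.B (circ Ψ (Form.or' α β)) = ES.B (circ Ψ α) ∨
    ES.B (circ Ψ (Form.or' α β)) = ES.B (circ Ψ β) ∨
    ES.B (circ Ψ (Form.or' α β)) = ES.B (circ Ψ α) ∩ ES.B (circ Ψ β)

/-- Credibility-limited revision operator: satisfies (CL1)–(CL6). -/
def CLRev (ES : EpistemicSpace V E) (circ : E → Form V → E) : Prop :=
  CL1 ES circ ∧ CL2 ES circ ∧ CL3 ES circ ∧ CL4 ES circ ∧ CL5 ES circ ∧ CL6 ES circ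

/-- (ECL1) = (CL1). -/
def ECL1 (ES : EpistemicSpace V E) (circ : E → Form V → E) : Prop :=
  ∀ Ψ α, α ∈ ES.B (circ Ψ α) ∨ ES.B (circ Ψ α) = ES.B Ψ

/-- (ECL2) = (CL2). -/
def ECL2 (ES : EpistemicSpace V E) (circ : E → Form V → E) : Prop :=
  ∀ Ψ α, SetConsistent (plus (ES.B Ψ) α) → ES.B (circ Ψ α) = plus (ES.B Ψ) α

/-- (ECL3) if `B(Ψ∘α)` is inconsistent then `B(Ψ)` or `α` is inconsistent. -/
def ECL3 (ES : EpistemicSpace V E) (circ : E → Form V → E) : Prop :=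
  ∀ Ψ α, ¬ SetConsistent (ES.B (circ Ψ α)) →
    ¬ SetConsistent (ES.B Ψ) ∨ ¬ FormConsistent α

/-- (ECL4) if `B(Ψ∘α)` is consistent and `α ⊨ β` then `B(Ψ∘β)` is consistent. -/
def ECL4 (ES : EpistemicSpace V E) (circ : E → Form V → E) : Prop :=
  ∀ Ψ α β, SetConsistent (ES.B (circ Ψ α)) → mods α ⊆ mods β →
    SetConsistent (ES.B (circ Ψ β))

/-- (ECL5) = (CL4). -/
def ECL5 (ES : EpistemicSpace V E) (circ : E → Form V → E) : Prop :=
  ∀ Ψ α β, mods α = mods β → ES.B (circ Ψ α) = ES.B (circ Ψ β)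

/-- (ECL6) = (CL5). -/
def ECL6 (ES : EpistemicSpace V E) (circ : E → Form V → E) : Prop :=
  ∀ Ψ α β, α ∈ ES.B (circ Ψ α) → mods α ⊆ mods β → β ∈ ES.B (circ Ψ β)

/-- (ECL7) = (CL6). -/
def ECL7 (ES : EpistemicSpace V E) (circ : E → Form V → E) : Prop :=
  ∀ Ψ α β,
    ES.B (circ Ψ (Form.or' α β)) = ES.B (circ Ψ α) ∨
    ES.B (circ Ψ (Form.or' α β)) = ES.B (circ Ψ β) ∨
    ES.B (circ Ψ (Form.or' α β)) = ES.B (circ Ψ α) ∩ ES.B (circ Ψ β)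

/-- Extended credibility-limited revision operator: satisfies (ECL1)–(ECL7). -/
def ECLRev (ES : EpistemicSpace V E) (circ : E → Form V → E) : Prop :=
  ECL1 ES circ ∧ ECL2 ES circ ∧ ECL3 ES circ ∧ ECL4 ES circ ∧
    ECL5 ES circ ∧ ECL6 ES circ ∧ ECL7 ES circ

/-- `min(X,⪯) = {ω ∈ X : ω ⪯ ω' for all ω' ∈ X}`. -/
def minSet {W : Type} (X : Set W) (le : W → W → Prop) : Set W :=
  {ω ∈ X | ∀ ω' ∈ X, le ω ω'}

/-- The data of a credibility-limited assignment `Ψ ↦ (⪯_Ψ, C_Ψ, b_Ψ)`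
(with `b_Ψ = ⊤` rendered as `true`, `b_Ψ = ⊥` as `false`). -/
structure CLAssignment (V E : Type) where
  le : E → World V → World V → Prop
  C : E → Set (World V)
  b : E → Bool

/-- `A` is a credibility-limited assignment for `ES`: `⟦Ψ⟧ ⊆ C_Ψ`,
`⪯_Ψ` is a total preorder on `C_Ψ`, and (CLA⊥): if `b_Ψ = ⊥` then `C_Ψ = Ω`. -/
def IsCLAssignment (ES : EpistemicSpace V E) (A : CLAssignment V E) : Prop :=
  (∀ Ψ, modsOf ES Ψ ⊆ A.C Ψ) ∧
  (∀ Ψ, ∀ ω₁ ∈ A.C Ψ, ∀ ω₂ ∈ A.C Ψ, A.le Ψ ω₁ ω₂ ∨ A.le Ψ ω₂ ω₁) ∧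
  (∀ Ψ, ∀ ω₁ ∈ A.C Ψ, ∀ ω₂ ∈ A.C Ψ, ∀ ω₃ ∈ A.C Ψ,
      A.le Ψ ω₁ ω₂ → A.le Ψ ω₂ ω₃ → A.le Ψ ω₁ ω₃) ∧
  (∀ Ψ, A.b Ψ = false → A.C Ψ = Set.univ)

/-- Faithfulness: (CLFA1) and (CLFA2). -/
def Faithful (ES : EpistemicSpace V E) (A : CLAssignment V E) : Prop :=
  (∀ (Ψ : E) (ω₁ ω₂ : World V), ω₁ ∈ modsOf ES Ψ → ω₂ ∈ modsOf ES Ψ →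
      A.le Ψ ω₁ ω₂ ∧ A.le Ψ ω₂ ω₁) ∧
  (∀ (Ψ : E) (ω₁ ω₂ : World V), ω₁ ∈ modsOf ES Ψ → ω₂ ∉ modsOf ES Ψ →
      A.le Ψ ω₁ ω₂ ∧ ¬ A.le Ψ ω₂ ω₁)

/-- Revision-compatibility of an assignment with a belief change operator:
`⟦Ψ∘α⟧ = min(⟦α⟧,⪯_Ψ)` if `⟦α⟧ ∩ C_Ψ ≠ ∅`; `⟦Ψ∘α⟧ = ∅` if `⟦α⟧ = ∅` and
`b_Ψ = ⊥`; and `⟦Ψ∘α⟧ = ⟦Ψ⟧` otherwise. -/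
def RevCompatible (ES : EpistemicSpace V E) (circ : E → Form V → E)
    (A : CLAssignment V E) : Prop :=
  ∀ Ψ α,
    ((mods α ∩ A.C Ψ).Nonempty →
      modsOf ES (circ Ψ α) = minSet (mods α) (A.le Ψ)) ∧
    (mods α = ∅ → A.b Ψ = false → modsOf ES (circ Ψ α) = ∅) ∧
    (¬ (mods α ∩ A.C Ψ).Nonempty → ¬ (mods α = ∅ ∧ A.b Ψ = false) →
      modsOf ES (circ Ψ α) = modsOf ES Ψ)


/-- The belief sets of the two states: all formulas for `Ψ_⊥`, the formulas true in the
world `a` for `Ψ_a`. -/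
def twoStateBelief (Ψ : Bool) : Set (Form Unit) :=
  {φ | Ψ = true → φ.eval (fun _ => true) = true}

theorem modsSet_twoStateBelief_false : modsSet (twoStateBelief false) = ∅ := by
  ext w
  simp only [modsSet, twoStateBelief, Set.mem_ofPred_eq, Set.mem_empty_iff_false, iff_false]
  intro h
  simpa [Form.eval] using h Form.fls (by simp)

theorem modsSet_twoStateBelief_true :
    modsSet (twoStateBelief true) = {fun _ => true} := by
  ext w
  simp only [modsSet, twoStateBelief, Set.mem_ofPred_eq, Set.mem_singleton_iff]
  constructor
  · intro h
    have ha : w () = true := h (Form.atom ()) (fun _ => rfl)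
    exact funext fun _ => ha
  · rintro rfl φ hφ
    exact hφ trivial

theorem twoStateBelief_closed (Ψ : Bool) : twoStateBelief Ψ = Cn (twoStateBelief Ψ) := by
  cases Ψ
  · rw [Cn, modsSet_twoStateBelief_false]
    simp [twoStateBelief]
  · rw [Cn, modsSet_twoStateBelief_true]
    simp [twoStateBelief, mods]

/-- The epistemic space with the states `Ψ_⊥ = false` and `Ψ_a = true`. -/
def twoStateSpace : EpistemicSpace Unit Bool := ⟨twoStateBelief, twoStateBelief_closed⟩

/-- The change operator: move to `Ψ_a` on input `a`, stay on a tautology, and move to `Ψ_⊥`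
otherwise. -/
def twoStateChange (Ψ : Bool) (α : Form Unit) : Bool :=
  α.eval (fun _ => true) && (!(α.eval (fun _ => false)) || Ψ)

theorem mem_twoStateSpace {Ψ : Bool} {φ : Form Unit} :
    φ ∈ twoStateSpace.B Ψ ↔ (Ψ = true → φ.eval (fun _ => true) = true) := Iff.rfl

theorem modsSet_union_singleton {V : Type} (X : Set (Form V)) (α : Form V) :
    modsSet (X ∪ {α}) = modsSet X ∩ mods α := by
  ext w
  simp [modsSet, mods, or_imp, forall_and, and_comm]

theorem modsSet_Cn {V : Type} (X : Set (Form V)) : modsSet (Cn X) = modsSet X := by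
  ext w
  exact ⟨fun h φ hφ => h φ fun _ hv => hv φ hφ, fun h _ hφ => hφ w h⟩

theorem eval_eq_of_mods_eq {V : Type} {α β : Form V} (h : mods α = mods β) (w : World V) :
    α.eval w = β.eval w :=
  Bool.eq_iff_iff.2 (Set.ext_iff.1 h w)

theorem twoStateChange_CL2 : CL2 twoStateSpace twoStateChange := by
  intro Ψ α h
  have h' : (modsSet (twoStateBelief Ψ) ∩ mods α).Nonempty := by
    rwa [← modsSet_union_singleton, ← modsSet_Cn]
  cases Ψ
  · simp [modsSet_twoStateBelief_false] at h'
  · rw [modsSet_twoStateBelief_true, Set.singleton_inter_nonempty] at h'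
    have hc : twoStateChange true α = true := by
      have : α.eval (fun _ => true) = true := h'
      simp [twoStateChange, this]
    have hm : modsSet (twoStateBelief true ∪ {α}) = modsSet (twoStateBelief true) := by
      rw [modsSet_union_singleton, modsSet_twoStateBelief_true]
      exact Set.inter_eq_left.2 (Set.singleton_subset_iff.2 h')
    rw [hc]
    change twoStateBelief true = Cn (twoStateBelief true ∪ {α})
    rw [Cn, hm]
    exact twoStateBelief_closed true

/-- There exists an epistemic space over the single-atom signature
(states `Ψ_⊥ = false`, `Ψ_a = true`, with `⟦Ψ_⊥⟧ = ∅` and `⟦Ψ_a⟧ = {a}`) and a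
belief change operator (defined by the indicated case distinction on `⟦α⟧`) that
satisfies (CL1), (CL2), (CL4), (CL5), (CL6) but violates (CL3). -/
theorem stmt4 :
    ∃ (ES : EpistemicSpace Unit Bool) (circ : Bool → Form Unit → Bool),
      modsOf ES false = (∅ : Set (World Unit)) ∧
      modsOf ES true = ({fun _ => true} : Set (World Unit)) ∧
      (∀ (Ψ : Bool) (α : Form Unit),
        mods α = ({fun _ => true} : Set (World Unit)) → circ Ψ α = true) ∧
      (∀ (Ψ : Bool) (α : Form Unit),
        mods α = ({fun _ => false} : Set (World Unit)) ∨ mods α = (∅ : Set (World Unit)) →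
          circ Ψ α = false) ∧
      (∀ (Ψ : Bool) (α : Form Unit),
        mods α = (Set.univ : Set (World Unit)) → circ Ψ α = Ψ) ∧
      CL1 ES circ ∧ CL2 ES circ ∧ CL4 ES circ ∧ CL5 ES circ ∧ CL6 ES circ ∧
      ¬ CL3 ES circ := by
  have hne : (fun _ => false : World Unit) ≠ fun _ => true := fun h => by
    simpa using congrFun h ()
  refine ⟨twoStateSpace, twoStateChange, modsSet_twoStateBelief_false,
    modsSet_twoStateBelief_true, ?_, ?_, ?_, ?_, twoStateChange_CL2, ?_, ?_, ?_, ?_⟩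
  · intro Ψ α h
    have ht : (fun _ => true) ∈ mods α := by simp [h]
    have hf : (fun _ => false) ∉ mods α := by simpa [h] using hne
    simp only [mods, Set.mem_ofPred_eq] at ht hf
    simp [twoStateChange, ht, hf]
  · intro Ψ α h
    have ht : (fun _ => true) ∉ mods α := by
      rcases h with h | h
      · simpa [h] using hne.symm
      · simp [h]
    simp only [mods, Set.mem_ofPred_eq] at ht
    simp [twoStateChange, ht]
  · intro Ψ α h
    have h' : ∀ w, α.eval w = true := Set.eq_univ_iff_forall.1 h
    simp [twoStateChange, h']
  · intro Ψ α
    left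
    simp only [mem_twoStateSpace, twoStateChange, Bool.and_eq_true]
    exact And.left
  · intro Ψ α β h
    simp only [twoStateChange, eval_eq_of_mods_eq h]
  · intro Ψ α β _ _
    simp only [mem_twoStateSpace, twoStateChange, Bool.and_eq_true]
    exact And.left
  · intro Ψ α β
    have h : twoStateChange Ψ (Form.or' α β) = twoStateChange Ψ α ∨
        twoStateChange Ψ (Form.or' α β) = twoStateChange Ψ β := by
      simp only [twoStateChange, Form.or', Form.neg, Form.eval]
      generalize α.eval (fun _ => true) = p
      generalize α.eval (fun _ => false) = q
      generalize β.eval (fun _ => true) = r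
      generalize β.eval (fun _ => false) = s
      revert Ψ p q r s
      decide
    rcases h with h | h
    · exact Or.inl (congrArg _ h)
    · exact Or.inr (Or.inl (congrArg _ h))
  · intro h
    have h' : (modsSet (twoStateBelief false)).Nonempty := h false Form.fls
    simp [modsSet_twoStateBelief_false] at h'

end CLR
end

section
/- Let 𝔼 = ⟨ℰ, B⟩ be an epistemic space and ∘ an extended credibility-limited revision operator for 𝔼 (i.e., ∘ satisfies (ECL1)–(ECL7)). Then there exists a faithful credibility-limited assignment Ψ ↦ (⪯_Ψ, C_Ψ, b_Ψ) for 𝔼 that is revision-compatible with ∘. -/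
namespace CLR

variable {V E : Type}

section Definability

theorem mods_fls {V : Type} : mods (Form.fls : Form V) = ∅ := by
  ext w; simp [mods, Form.eval]

theorem mods_neg {V : Type} (φ : Form V) : mods φ.neg = (mods φ)ᶜ := by
  ext w; simp [mods, Form.eval, Form.neg]

theorem mods_or' {V : Type} (φ ψ : Form V) : mods (φ.or' ψ) = mods φ ∪ mods ψ := by
  ext w; simp [mods, Form.eval, Form.neg, Form.or']

theorem mods_and' {V : Type} (φ ψ : Form V) : mods (φ.and' ψ) = mods φ ∩ mods ψ := by
  simp [Form.and', mods_neg, mods_or']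

/-- Over a finite signature, every single interpretation is definable. -/
theorem exists_mods_eq_singleton {V : Type} [Fintype V] (w : World V) :
    ∃ φ : Form V, mods φ = {w} := by
  classical
  have key : ∀ s : Finset V, ∃ φ : Form V, mods φ = {u | ∀ v ∈ s, u v = w v} := by
    intro s
    induction s using Finset.induction_on with
    | empty => exact ⟨Form.tru, by simp [Form.tru, mods_neg, mods_fls]⟩
    | insert a s _ ih =>
      obtain ⟨φ, hφ⟩ := ih
      have hlit : ∃ ψ : Form V, mods ψ = {u | u a = w a} := by
        cases hw : w a with
        | true => exact ⟨Form.atom a, by ext u; simp [mods, Form.eval]⟩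
        | false => exact ⟨(Form.atom a).neg, by ext u; simp [mods, Form.neg, Form.eval]⟩
      obtain ⟨ψ, hψ⟩ := hlit
      refine ⟨ψ.and' φ, ?_⟩
      rw [mods_and', hφ, hψ]
      ext u
      simp
  obtain ⟨φ, hφ⟩ := key Finset.univ
  refine ⟨φ, hφ.trans ?_⟩
  ext u
  simp [funext_iff]

/-- Over a finite signature, every set of interpretations is definable. -/
theorem exists_mods_eq {V : Type} [Fintype V] (S : Set (World V)) :
    ∃ φ : Form V, mods φ = S := by
  classical
  induction S, S.toFinite using Set.Finite.induction_on with
  | empty => exact ⟨Form.fls, mods_fls⟩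
  | @insert w S _ _ ih =>
    obtain ⟨φ, hφ⟩ := ih
    obtain ⟨ψ, hψ⟩ := exists_mods_eq_singleton w
    exact ⟨ψ.or' φ, by rw [mods_or', hφ, hψ, Set.singleton_union]⟩

end Definability

section Models

theorem modsSet_plus {V : Type} (X : Set (Form V)) (α : Form V) :
    modsSet (plus X α) = modsSet X ∩ mods α := by
  rw [plus, modsSet_Cn]
  ext w
  simp [modsSet, mods, or_imp, forall_and, and_comm]

theorem mem_B_iff {V E : Type} (ES : EpistemicSpace V E) (Ψ : E) (α : Form V) :
    α ∈ ES.B Ψ ↔ modsOf ES Ψ ⊆ mods α := by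
  rw [ES.closed Ψ]
  rfl

theorem modsSet_B_inter {V E : Type} (ES : EpistemicSpace V E) (Φ Ψ : E) :
    modsSet (ES.B Φ ∩ ES.B Ψ) = modsOf ES Φ ∪ modsOf ES Ψ := by
  ext w
  constructor
  · intro hw
    by_contra hcon
    simp only [Set.mem_union, not_or] at hcon
    obtain ⟨h₁, h₂⟩ := hcon
    simp only [modsOf, modsSet, Set.mem_ofPred_eq, not_forall] at h₁ h₂
    obtain ⟨φ, hφ, hφw⟩ := h₁
    obtain ⟨ψ, hψ, hψw⟩ := h₂
    have hmem : w ∈ mods (φ.or' ψ) := by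
      refine hw _ ⟨(mem_B_iff ..).2 ?_, (mem_B_iff ..).2 ?_⟩ <;> rw [mods_or']
      · exact ((mem_B_iff ..).1 hφ).trans Set.subset_union_left
      · exact ((mem_B_iff ..).1 hψ).trans Set.subset_union_right
    rw [mods_or'] at hmem
    exact hmem.elim hφw hψw
  · rintro (hw | hw) φ ⟨h₁, h₂⟩
    exacts [hw φ h₁, hw φ h₂]

end Models

/-- The semantic counterpart of the postulates (ECL1)–(ECL7) at a fixed epistemic state:
`K` is the set of models of the prior beliefs, and `f S` the set of models of the beliefs
after revising by a formula with models `S`. -/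
structure IsLimitedChoice {W : Type} (K : Set W) (f : Set W → Set W) : Prop where
  success_or_eq : ∀ S, f S ⊆ S ∨ f S = K
  vacuity : ∀ S, (K ∩ S).Nonempty → f S = K ∩ S
  eq_empty : ∀ S, f S = ∅ → K = ∅ ∨ S = ∅
  nonempty_mono : ∀ S T, (f S).Nonempty → S ⊆ T → (f T).Nonempty
  success_mono : ∀ S T, f S ⊆ S → S ⊆ T → f T ⊆ T
  union : ∀ S T, f (S ∪ T) = f S ∨ f (S ∪ T) = f T ∨ f (S ∪ T) = f S ∪ f T

/-- The credible interpretations of a limited choice function. -/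
def credible {W : Type} (f : Set W → Set W) : Set W := {w | f {w} = {w}}

namespace IsLimitedChoice

variable {W : Type} {K : Set W} {f : Set W → Set W}

theorem prior_subset_credible (h : IsLimitedChoice K f) : K ⊆ credible f := by
  intro w hw
  have := h.vacuity {w} ⟨w, hw, rfl⟩
  rwa [Set.inter_eq_right.2 (Set.singleton_subset_iff.2 hw)] at this

theorem subset_credible (h : IsLimitedChoice K f) (S : Set W) : f S ⊆ credible f := by
  intro w hw
  by_contra hwC
  have hwK : w ∉ K := fun hk => hwC (h.prior_subset_credible hk)
  have hwS : w ∈ S := by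
    rcases h.success_or_eq S with hS | hS
    · exact hS hw
    · exact absurd (hS ▸ hw) hwK
  have h₁ : w ∉ f {w} := by
    intro hmem
    rcases h.success_or_eq {w} with hs | hs
    · exact hwC (hs.antisymm (Set.singleton_subset_iff.2 hmem))
    · exact hwK (hs ▸ hmem)
  have h₂ : w ∉ f (S \ {w}) := by
    intro hmem
    rcases h.success_or_eq (S \ {w}) with hs | hs
    · exact (hs hmem).2 rfl
    · exact hwK (hs ▸ hmem)
  have hu := h.union {w} (S \ {w})
  rw [Set.union_sdiff_cancel (Set.singleton_subset_iff.2 hwS)] at hu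
  rcases hu with hu | hu | hu <;> rw [hu] at hw
  · exact h₁ hw
  · exact h₂ hw
  · exact hw.elim h₁ h₂

theorem subset_of_inter_credible (h : IsLimitedChoice K f) {S : Set W}
    (hS : (S ∩ credible f).Nonempty) : f S ⊆ S := by
  obtain ⟨w, hwS, hw⟩ := hS
  exact h.success_mono {w} S (le_of_eq hw) (Set.singleton_subset_iff.2 hwS)

theorem nonempty_of_inter_credible (h : IsLimitedChoice K f) {S : Set W}
    (hS : (S ∩ credible f).Nonempty) : (f S).Nonempty := by
  obtain ⟨w, hwS, hw⟩ := hS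
  refine h.nonempty_mono {w} S ?_ (Set.singleton_subset_iff.2 hwS)
  rw [show f {w} = {w} from hw]
  exact Set.singleton_nonempty w

theorem eq_prior (h : IsLimitedChoice K f) {S : Set W} (hne : S.Nonempty)
    (hS : ¬ (S ∩ credible f).Nonempty) : f S = K := by
  rcases h.success_or_eq S with hs | hs
  · have hf : f S = ∅ := Set.eq_empty_of_forall_notMem fun w hw =>
      hS ⟨w, hs hw, h.subset_credible S hw⟩
    rw [hf, (h.eq_empty S hf).resolve_right hne.ne_empty]
  · exact hs

/-- Independence of irrelevant alternatives. -/
theorem eq_inter_of_subset (h : IsLimitedChoice K f) {S T : Set W} (hST : S ⊆ T)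
    (hne : (f T ∩ S).Nonempty) : f S = f T ∩ S := by
  obtain ⟨w, hwT, hwS⟩ := hne
  have hS : f S ⊆ S := h.subset_of_inter_credible ⟨w, hwS, h.subset_credible T hwT⟩
  by_cases hK : (K ∩ S).Nonempty
  · obtain ⟨k, hkK, hkS⟩ := hK
    rw [h.vacuity S ⟨k, hkK, hkS⟩, h.vacuity T ⟨k, hkK, hST hkS⟩, Set.inter_assoc,
      Set.inter_eq_right.2 hST]
  · have hdisj : f (T \ S) ∩ S = ∅ := by
      refine Set.eq_empty_of_forall_notMem fun u hu => ?_
      rcases h.success_or_eq (T \ S) with hs | hs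
      · exact (hs hu.1).2 hu.2
      · exact hK ⟨u, hs ▸ hu.1, hu.2⟩
    have hu := h.union S (T \ S)
    rw [Set.union_sdiff_cancel hST] at hu
    rcases hu with hu | hu | hu
    · rw [hu, Set.inter_eq_left.2 hS]
    · exact absurd (hu ▸ ⟨hwT, hwS⟩ : w ∈ f (T \ S) ∩ S) (by simp [hdisj])
    · rw [hu, Set.union_inter_distrib_right, hdisj, Set.union_empty, Set.inter_eq_left.2 hS]

theorem mem_of_mem_pair (h : IsLimitedChoice K f) {S : Set W} {a b : W} (ha : a ∈ S)
    (hb : b ∈ S) (hbf : b ∈ f S) (hab : a ∈ f {a, b}) : a ∈ f S := by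
  rw [h.eq_inter_of_subset (T := S) (Set.pair_subset ha hb) ⟨b, hbf, by simp⟩] at hab
  exact hab.1

theorem mem_pair_of_mem (h : IsLimitedChoice K f) {S : Set W} {a b : W} (ha : a ∈ S)
    (hb : b ∈ S) (haf : a ∈ f S) : a ∈ f {a, b} := by
  rw [h.eq_inter_of_subset (T := S) (Set.pair_subset ha hb) ⟨a, haf, by simp⟩]
  exact ⟨haf, by simp⟩

theorem eq_minSet (h : IsLimitedChoice K f) {S : Set W} (hS : (S ∩ credible f).Nonempty) :
    f S = minSet S fun a b => a ∈ f {a, b} := by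
  have hsub := h.subset_of_inter_credible hS
  refine Set.Subset.antisymm
    (fun a ha => ⟨hsub ha, fun b hb => h.mem_pair_of_mem (hsub ha) hb ha⟩) ?_
  rintro a ⟨ha, hmin⟩
  obtain ⟨b, hb⟩ := h.nonempty_of_inter_credible hS
  exact h.mem_of_mem_pair ha (hsub hb) hb (hmin b (hsub hb))

theorem pair_total (h : IsLimitedChoice K f) {a b : W} (ha : a ∈ credible f) :
    a ∈ f {a, b} ∨ b ∈ f {b, a} := by
  have hS : (({a, b} : Set W) ∩ credible f).Nonempty := ⟨a, by simp, ha⟩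
  obtain ⟨c, hc⟩ := h.nonempty_of_inter_credible hS
  rcases h.subset_of_inter_credible hS hc with rfl | hcb
  · exact Or.inl hc
  · rw [Set.mem_singleton_iff] at hcb
    subst hcb
    exact Or.inr (Set.pair_comm a c ▸ hc)

theorem pair_trans (h : IsLimitedChoice K f) {a b c : W} (ha : a ∈ credible f)
    (hab : a ∈ f {a, b}) (hbc : b ∈ f {b, c}) : a ∈ f {a, c} := by
  have hS : (({a, b, c} : Set W) ∩ credible f).Nonempty := ⟨a, by simp, ha⟩
  have hb_imp : b ∈ f {a, b, c} → a ∈ f {a, b, c} := fun hb =>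
    h.mem_of_mem_pair (by simp) (by simp) hb hab
  have hmem : a ∈ f {a, b, c} := by
    obtain ⟨d, hd⟩ := h.nonempty_of_inter_credible hS
    rcases h.subset_of_inter_credible hS hd with rfl | rfl | hdc
    · exact hd
    · exact hb_imp hd
    · rw [Set.mem_singleton_iff] at hdc
      subst hdc
      exact hb_imp (h.mem_of_mem_pair (by simp) (by simp) hd hbc)
  exact h.mem_pair_of_mem (by simp) (by simp) hmem

theorem pair_of_mem_prior (h : IsLimitedChoice K f) {a b : W} (ha : a ∈ K) :
    f {a, b} = K ∩ {a, b} :=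
  h.vacuity _ ⟨a, ha, by simp⟩

theorem credible_eq_univ (h : IsLimitedChoice K f) (hf : f ∅ ≠ K) : credible f = Set.univ := by
  have hsub : f ∅ ⊆ ∅ := (h.success_or_eq ∅).resolve_right hf
  refine Set.eq_univ_of_forall fun w => ?_
  have hw := h.success_mono ∅ {w} hsub (Set.empty_subset _)
  rcases Set.subset_singleton_iff_eq.1 hw with he | he
  · rcases h.eq_empty _ he with hK | hw'
    · exact absurd ((Set.subset_empty_iff.1 hsub).trans hK.symm) hf
    · exact absurd hw' (Set.singleton_ne_empty w)
  · exact he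

end IsLimitedChoice

theorem ECLRev.modsOf_congr {V E : Type} {ES : EpistemicSpace V E} {circ : E → Form V → E}
    (h : ECLRev ES circ) (Ψ : E) {α β : Form V} (hαβ : mods α = mods β) :
    modsOf ES (circ Ψ α) = modsOf ES (circ Ψ β) :=
  congrArg modsSet (h.2.2.2.2.1 Ψ α β hαβ)

/-- An operator satisfying (ECL1)–(ECL7) induces a limited choice function at each state. -/
theorem ECLRev.isLimitedChoice {V E : Type} {ES : EpistemicSpace V E}
    {circ : E → Form V → E} (h : ECLRev ES circ) (Ψ : E) {φ : Set (World V) → Form V}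
    (hφ : ∀ S, mods (φ S) = S) :
    IsLimitedChoice (modsOf ES Ψ) fun S => modsOf ES (circ Ψ (φ S)) := by
  have hcongr := fun α β => h.modsOf_congr Ψ (α := α) (β := β)
  obtain ⟨h1, h2, h3, h4, _, h6, h7⟩ := h
  refine ⟨fun S => ?_, fun S hS => ?_, fun S hS => ?_, fun S T hS hST => ?_,
    fun S T hS hST => ?_, fun S T => ?_⟩
  · refine (h1 Ψ (φ S)).imp (fun hm => ?_) (congrArg modsSet)
    rwa [mem_B_iff, hφ] at hm
  · have hplus : modsSet (plus (ES.B Ψ) (φ S)) = modsOf ES Ψ ∩ S := by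
      rw [modsSet_plus, hφ]; rfl
    rw [← hplus] at hS ⊢
    exact congrArg modsSet (h2 Ψ (φ S) hS)
  · have := h3 Ψ (φ S) (Set.not_nonempty_iff_eq_empty.2 hS)
    simpa only [SetConsistent, FormConsistent, modsOf, hφ, Set.not_nonempty_iff_eq_empty] using this
  · exact h4 Ψ (φ S) (φ T) hS (by rwa [hφ, hφ])
  · have := h6 Ψ (φ S) (φ T)
    simp only [mem_B_iff, hφ] at this
    exact this hS hST
  · have hor : modsOf ES (circ Ψ (φ (S ∪ T))) = modsOf ES (circ Ψ ((φ S).or' (φ T))) :=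
      hcongr _ _ (by rw [mods_or', hφ, hφ, hφ])
    simp only [hor]
    refine (h7 Ψ (φ S) (φ T)).imp (congrArg modsSet) (Or.imp (congrArg modsSet) fun he => ?_)
    exact (congrArg modsSet he).trans (modsSet_B_inter ES _ _)

/-- Every extended credibility-limited revision operator has a faithful
credibility-limited assignment that is revision-compatible with it. -/
theorem stmt6 {V E : Type} [Nonempty V] [Fintype V] [Nonempty E]
    (ES : EpistemicSpace V E) (circ : E → Form V → E)
    (h : ECLRev ES circ) :
    ∃ A : CLAssignment V E,
      IsCLAssignment ES A ∧ Faithful ES A ∧ RevCompatible ES circ A := by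
  classical
  choose φ hφ using exists_mods_eq (V := V)
  let f : E → Set (World V) → Set (World V) := fun Ψ S => modsOf ES (circ Ψ (φ S))
  have hf : ∀ Ψ, IsLimitedChoice (modsOf ES Ψ) (f Ψ) := fun Ψ => h.isLimitedChoice Ψ hφ
  have hcirc : ∀ Ψ α, modsOf ES (circ Ψ α) = f Ψ (mods α) := fun Ψ α =>
    h.modsOf_congr Ψ (hφ (mods α)).symm
  refine ⟨⟨fun Ψ a b => a ∈ f Ψ {a, b}, fun Ψ => credible (f Ψ),
    fun Ψ => decide (f Ψ ∅ = modsOf ES Ψ)⟩, ⟨fun Ψ => (hf Ψ).prior_subset_credible,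
      fun Ψ a ha b _ => (hf Ψ).pair_total ha,
      fun Ψ a ha b _ c _ hab hbc => (hf Ψ).pair_trans ha hab hbc,
      fun Ψ hb => (hf Ψ).credible_eq_univ (of_decide_eq_false hb)⟩, ⟨?_, ?_⟩, ?_⟩
  · intro Ψ a b ha hb
    simp [(hf Ψ).pair_of_mem_prior ha, (hf Ψ).pair_of_mem_prior hb, ha, hb]
  · intro Ψ a b ha hb
    simp [Set.pair_comm b a, (hf Ψ).pair_of_mem_prior ha, ha, hb]
  · intro Ψ α
    rw [hcirc]
    refine ⟨(hf Ψ).eq_minSet, fun hα hb => ?_, fun hC hb => ?_⟩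
    · rw [hα]
      exact Set.subset_empty_iff.1
        (((hf Ψ).success_or_eq ∅).resolve_right (of_decide_eq_false hb))
    · rcases (mods α).eq_empty_or_nonempty with hα | hα
      · rw [hα]
        by_contra hne
        exact hb ⟨hα, decide_eq_false hne⟩
      · exact (hf Ψ).eq_prior hα hC

end CLR
end

section
/- For each epistemic space 𝔼, every AGM revision operator for 𝔼 is an extended credibility-limited revision operator for 𝔼: if ∘ satisfies (R1)–(R6) then ∘ satisfies (ECL1)–(ECL7). -/
namespace CLR

variable {V E : Type}

theorem mem_plus {X : Set (Form V)} {α φ : Form V} :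
    φ ∈ plus X α ↔ ∀ w ∈ modsSet X, w ∈ mods α → w ∈ mods φ := by
  constructor
  · intro h w hX hα
    refine h w fun ψ hψ => ?_
    rcases hψ with hψ | rfl
    exacts [hX ψ hψ, hα]
  · intro h w hw
    exact h w (fun ψ hψ => hw ψ (Or.inl hψ)) (hw α (Or.inr rfl))

theorem setConsistent_plus {X : Set (Form V)} {α : Form V} :
    SetConsistent (plus X α) ↔ ∃ w ∈ modsSet X, w ∈ mods α := by
  constructor
  · rintro ⟨w, hw⟩
    exact ⟨w, fun ψ hψ => hw ψ (mem_plus.2 fun v hv _ => hv ψ hψ),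
      hw α (mem_plus.2 fun _ _ h => h)⟩
  · rintro ⟨w, hX, hα⟩
    exact ⟨w, fun ψ hψ => mem_plus.1 hψ w hX hα⟩

theorem EpistemicSpace.mem_B (ES : EpistemicSpace V E) {Ψ : E} {φ : Form V} :
    φ ∈ ES.B Ψ ↔ ∀ w ∈ modsOf ES Ψ, w ∈ mods φ := by
  constructor
  · exact fun h w hw => hw φ h
  · intro h
    rw [ES.closed Ψ]
    exact h

theorem mods_and'_s11 (α β : Form V) : mods (Form.and' α β) = mods α ∩ mods β := by
  ext w
  simp [mods, Form.and', Form.or', Form.neg, Form.eval]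

theorem mods_or'_s11 (α β : Form V) : mods (Form.or' α β) = mods α ∪ mods β := by
  ext w
  simp [mods, Form.or', Form.neg, Form.eval]

/-- Revising by a stronger formula that is consistent with the revision by a weaker one
amounts to expanding the latter. -/
theorem AGMRev.eq_plus_of_subset {ES : EpistemicSpace V E} {circ : E → Form V → E}
    (h : AGMRev ES circ) {Ψ : E} {α β : Form V} (hs : mods β ⊆ mods α)
    (hc : SetConsistent (plus (ES.B (circ Ψ α)) β)) :
    ES.B (circ Ψ β) = plus (ES.B (circ Ψ α)) β := by
  obtain ⟨-, -, -, h4, h5, h6⟩ := h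
  rw [h4 Ψ β (Form.and' α β) (by rw [mods_and'_s11, Set.inter_eq_right.2 hs])]
  exact (h5 Ψ α β).antisymm (h6 Ψ α β hc)

theorem AGMRev.setConsistent_iff {ES : EpistemicSpace V E} {circ : E → Form V → E}
    (h : AGMRev ES circ) {Ψ : E} {α : Form V} :
    SetConsistent (ES.B (circ Ψ α)) ↔ FormConsistent α :=
  ⟨fun ⟨w, hw⟩ => ⟨w, hw α (h.1 Ψ α)⟩, h.2.2.1 Ψ α⟩

/-- Disjunctive trichotomy for AGM revision. -/
theorem AGMRev.ecl7 {ES : EpistemicSpace V E} {circ : E → Form V → E}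
    (h : AGMRev ES circ) : ECL7 ES circ := by
  intro Ψ α β
  have hD : ∀ w ∈ modsOf ES (circ Ψ (Form.or' α β)), w ∈ mods α ∨ w ∈ mods β := by
    intro w hw
    have hwD : w ∈ mods (Form.or' α β) := hw _ (h.1 Ψ _)
    rwa [mods_or'_s11] at hwD
  have hα : mods α ⊆ mods (Form.or' α β) := by
    rw [mods_or'_s11]; exact Set.subset_union_left
  have hβ : mods β ⊆ mods (Form.or' α β) := by
    rw [mods_or'_s11]; exact Set.subset_union_right
  by_cases cα : SetConsistent (plus (ES.B (circ Ψ (Form.or' α β))) α) <;>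
    by_cases cβ : SetConsistent (plus (ES.B (circ Ψ (Form.or' α β))) β)
  · right; right
    rw [h.eq_plus_of_subset hα cα, h.eq_plus_of_subset hβ cβ]
    ext φ
    rw [Set.mem_inter_iff, mem_plus, mem_plus, ES.mem_B]
    exact ⟨fun H => ⟨fun w hw _ => H w hw, fun w hw _ => H w hw⟩,
      fun H w hw => (hD w hw).elim (H.1 w hw) (H.2 w hw)⟩
  · left
    rw [h.eq_plus_of_subset hα cα]
    ext φ
    rw [mem_plus, ES.mem_B]
    exact ⟨fun H w hw _ => H w hw, fun H w hw => H w hw <|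
      (hD w hw).resolve_right fun hwβ => cβ (setConsistent_plus.2 ⟨w, hw, hwβ⟩)⟩
  · right; left
    rw [h.eq_plus_of_subset hβ cβ]
    ext φ
    rw [mem_plus, ES.mem_B]
    exact ⟨fun H w hw _ => H w hw, fun H w hw => H w hw <|
      (hD w hw).resolve_left fun hwα => cα (setConsistent_plus.2 ⟨w, hw, hwα⟩)⟩
  · left
    have hempty : mods (Form.or' α β) = ∅ := by
      by_contra hne
      obtain ⟨w, hw⟩ := h.setConsistent_iff (Ψ := Ψ).2 (Set.nonempty_iff_ne_empty.2 hne)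
      rcases hD w hw with hwα | hwβ
      · exact cα (setConsistent_plus.2 ⟨w, hw, hwα⟩)
      · exact cβ (setConsistent_plus.2 ⟨w, hw, hwβ⟩)
    exact h.2.2.2.1 Ψ _ _ (hempty.trans (Set.subset_empty_iff.1 (hempty ▸ hα)).symm)

/-- If `∘` satisfies (R1)–(R6) then `∘` satisfies (ECL1)–(ECL7). -/
theorem stmt11 {V E : Type} [Nonempty V] [Fintype V] [Nonempty E]
    (ES : EpistemicSpace V E) (circ : E → Form V → E)
    (h : AGMRev ES circ) :
    ECLRev ES circ := by
  refine ⟨fun Ψ α => Or.inl (h.1 Ψ α), h.2.1, fun Ψ α hn => Or.inr ?_, fun Ψ α β hc hs => ?_,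
    h.2.2.2.1, fun Ψ _ β _ _ => h.1 Ψ β, h.ecl7⟩
  · rwa [← h.setConsistent_iff (Ψ := Ψ)]
  · rw [h.setConsistent_iff] at hc ⊢
    exact hc.mono hs

end CLR
end

section
/- Let 𝔼 = ⟨ℰ, B⟩ be an epistemic space and ∘ a belief change operator for 𝔼 satisfying (ECL2). For each Ψ ∈ ℰ define, for interpretations ω₁, ω₂, ω₁ ⪯_Ψ ω₂ iff ω₁ ∈ ⟦Ψ∘φ_{ω₁,ω₂}⟧, where φ_{ω₁,ω₂} is any formula with ⟦φ_{ω₁,ω₂}⟧ = {ω₁, ω₂}. Then the faithfulness conditions hold: (CLFA1) if ω₁ ∈ ⟦Ψ⟧ and ω₂ ∈ ⟦Ψ⟧ then ω₁ ⪯_Ψ ω₂ and ω₂ ⪯_Ψ ω₁; (CLFA2) if ω₁ ∈ ⟦Ψ⟧ and ω₂ ∉ ⟦Ψ⟧ then ω₁ ⪯_Ψ ω₂ and not ω₂ ⪯_Ψ ω₁. -/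
namespace CLR

variable {V E : Type}

/-- The semantic form of (ECL2): `⟦Ψ∘α⟧ = ⟦Ψ⟧ ∩ ⟦α⟧` whenever the right-hand side is nonempty. -/
theorem ECL2.modsOf_circ {V E : Type} {ES : EpistemicSpace V E} {circ : E → Form V → E}
    (h : ECL2 ES circ) {Ψ : E} {α : Form V} (hne : (modsOf ES Ψ ∩ mods α).Nonempty) :
    modsOf ES (circ Ψ α) = modsOf ES Ψ ∩ mods α := by
  have hmods := modsSet_plus (ES.B Ψ) α
  rw [modsOf, h Ψ α (by rw [SetConsistent, hmods]; exact hne), hmods, modsOf]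

/-- If `∘` satisfies (ECL2) and `ω₁ ⪯_Ψ ω₂ ↔ ω₁ ∈ ⟦Ψ∘φ_{ω₁,ω₂}⟧`
(for a choice `f` of formulas with `⟦φ_{ω₁,ω₂}⟧ = {ω₁,ω₂}`), then the
faithfulness conditions (CLFA1) and (CLFA2) hold. -/
theorem stmt15 {V E : Type} [Nonempty V] [Fintype V] [Nonempty E]
    (ES : EpistemicSpace V E) (circ : E → Form V → E)
    (h2 : ECL2 ES circ)
    (f : World V → World V → Form V)
    (hf : ∀ ω₁ ω₂ : World V, mods (f ω₁ ω₂) = {ω₁, ω₂}) :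
    (∀ (Ψ : E) (ω₁ ω₂ : World V), ω₁ ∈ modsOf ES Ψ → ω₂ ∈ modsOf ES Ψ →
        ω₁ ∈ modsOf ES (circ Ψ (f ω₁ ω₂)) ∧ ω₂ ∈ modsOf ES (circ Ψ (f ω₂ ω₁))) ∧
    (∀ (Ψ : E) (ω₁ ω₂ : World V), ω₁ ∈ modsOf ES Ψ → ω₂ ∉ modsOf ES Ψ →
        ω₁ ∈ modsOf ES (circ Ψ (f ω₁ ω₂)) ∧ ω₂ ∉ modsOf ES (circ Ψ (f ω₂ ω₁))) := by
  have key (Ψ : E) (α : Form V) {ω : World V} (hω : ω ∈ modsOf ES Ψ) (hα : ω ∈ mods α) :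
      modsOf ES (circ Ψ α) = modsOf ES Ψ ∩ mods α :=
    h2.modsOf_circ ⟨ω, hω, hα⟩
  refine ⟨fun Ψ ω₁ ω₂ h₁ h₂ => ⟨?_, ?_⟩, fun Ψ ω₁ ω₂ h₁ h₂ => ⟨?_, ?_⟩⟩
  · rw [key Ψ _ h₁ (by simp [hf])]
    exact ⟨h₁, by simp [hf]⟩
  · rw [key Ψ _ h₂ (by simp [hf])]
    exact ⟨h₂, by simp [hf]⟩
  · rw [key Ψ _ h₁ (by simp [hf])]
    exact ⟨h₁, by simp [hf]⟩
  · rw [key Ψ _ h₁ (by simp [hf])]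
    exact fun h => h₂ h.1

end CLR
end

section
/- Let 𝔼 = ⟨ℰ, B⟩ be an epistemic space and ∘ an extended credibility-limited revision operator for 𝔼. For each Ψ ∈ ℰ define C_Ψ = {ω ∈ Ω : ⟦Ψ∘φ_ω⟧ = {ω}} and set b_Ψ = ⊥ if ⟦Ψ⟧ ≠ ∅ and ⊥ ∈ B(Ψ∘⊥), and b_Ψ = ⊤ otherwise. Then condition (CLA⊥) holds: if b_Ψ = ⊥ then C_Ψ = Ω. -/
namespace CLR

variable {V E : Type}

/-- For an extended credibility-limited revision operator, if
`b_Ψ = ⊥` (i.e. `⟦Ψ⟧ ≠ ∅` and `⊥ ∈ B(Ψ∘⊥)`), then `C_Ψ = Ω`, where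
`C_Ψ = {ω : ⟦Ψ∘φ_ω⟧ = {ω}}`. -/
theorem stmt16 {V E : Type} [Nonempty V] [Fintype V] [Nonempty E]
    (ES : EpistemicSpace V E) (circ : E → Form V → E)
    (h : ECLRev ES circ)
    (g : World V → Form V) (hg : ∀ ω : World V, mods (g ω) = {ω})
    (Ψ : E)
    (h1 : (modsOf ES Ψ).Nonempty)
    (h2 : Form.fls ∈ ES.B (circ Ψ Form.fls)) :
    {ω : World V | modsOf ES (circ Ψ (g ω)) = {ω}} = Set.univ := by
  obtain ⟨-, -, consistent, -, -, success, -⟩ := h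
  refine Set.eq_univ_of_forall fun ω => ?_
  have accepted : g ω ∈ ES.B (circ Ψ (g ω)) :=
    success Ψ Form.fls (g ω) h2 fun w hw => by simp [mods, Form.eval] at hw
  have nonempty : (modsOf ES (circ Ψ (g ω))).Nonempty := by
    by_contra inconsistent
    rcases consistent Ψ (g ω) inconsistent with hΨ | hω
    · exact hΨ h1
    · exact hω ⟨ω, by simp [hg]⟩
  refine nonempty.subset_singleton_iff.mp fun w hw => ?_
  rw [← hg ω]
  exact hw _ accepted

end CLR
end
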